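/- Let φ denote Euler's totient function. Then 2.2 < ∑_{d=1}^∞ 1/(d·φ(d)) < 2.23. -/

import Mathlib

theorem Nat.totient_prod_of_forall_prime {s : Finset ℕ} (hs : ∀ p ∈ s, p.Prime) :
    Nat.totient (∏ p ∈ s, p) = ∏ p ∈ s, (p - 1) := by
  have h := Nat.totient_mul_prod_primeFactors (∏ p ∈ s, p)
  rw [Nat.primeFactors_prod hs, mul_comm] at h
  exact Nat.eq_of_mul_eq_mul_left (Finset.prod_pos fun p hp ↦ (hs p hp).pos) h

/-- The identity `n / φ(n) = ∑_{e ∣ n} μ(e)² / φ(e)`. -/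
theorem Nat.sum_divisors_squarefree_inv_totient {n : ℕ} (hn : n ≠ 0) :
    ∑ e ∈ n.divisors with Squarefree e, ((Nat.totient e : ℝ))⁻¹ = n / Nat.totient n := by
  have hprime : ∀ p ∈ n.primeFactors, p.Prime := fun p hp ↦ Nat.prime_of_mem_primeFactors hp
  have hfactors : (UniqueFactorizationMonoid.normalizedFactors n).toFinset = n.primeFactors := by
    rw [Nat.factors_eq]
    rfl
  have hsum : ∑ e ∈ n.divisors with Squarefree e, ((Nat.totient e : ℝ))⁻¹ =
      ∏ p ∈ n.primeFactors, (1 + ((p : ℝ) - 1)⁻¹) := by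
    rw [Nat.sum_divisors_filter_squarefree hn, hfactors, Finset.prod_one_add]
    refine Finset.sum_congr rfl fun t ht ↦ ?_
    have ht' : ∀ p ∈ t, p.Prime := fun p hp ↦ hprime p (Finset.mem_powerset.1 ht hp)
    rw [Finset.prod_val, Finset.prod_inv_distrib]
    simp only [id]
    rw [Nat.totient_prod_of_forall_prime ht', Nat.cast_prod]
    refine congrArg _ (Finset.prod_congr rfl fun p hp ↦ ?_)
    rw [Nat.cast_pred (ht' p hp).pos]
  have htot : (Nat.totient n : ℝ) = n * ∏ p ∈ n.primeFactors, (1 - (p : ℝ)⁻¹) := by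
    simpa using congrArg (Rat.cast : ℚ → ℝ) (Nat.totient_eq_mul_prod_factors n)
  have hn' : (n : ℝ) ≠ 0 := Nat.cast_ne_zero.2 hn
  rw [hsum, htot, div_mul_cancel_left₀ hn', ← Finset.prod_inv_distrib]
  refine Finset.prod_congr rfl fun p hp ↦ ?_
  have hp1 : (1 : ℝ) < p := by exact_mod_cast (hprime p hp).one_lt
  have : (p : ℝ) - 1 ≠ 0 := by linarith
  field_simp
  ring

/-- The summand `μ(e)² / (e² φ(e))`. -/
def squarefreeTotientTerm (K : Type*) [Field K] (e : ℕ) : K :=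
  if Squarefree e then 1 / ((e : K) ^ 2 * (Nat.totient e : K)) else 0

theorem squarefreeTotientTerm_nonneg (e : ℕ) : 0 ≤ squarefreeTotientTerm ℝ e := by
  unfold squarefreeTotientTerm
  split_ifs <;> positivity

theorem squarefreeTotientTerm_le (e : ℕ) : squarefreeTotientTerm ℝ e ≤ ((e : ℝ) ^ 2)⁻¹ := by
  unfold squarefreeTotientTerm
  split_ifs with h
  · have he : 0 < e := Nat.pos_of_ne_zero h.ne_zero
    have : (1 : ℝ) ≤ Nat.totient e := by exact_mod_cast Nat.totient_pos.2 he
    rw [one_div]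
    exact inv_anti₀ (by positivity) (le_mul_of_one_le_right (by positivity) this)
  · positivity

theorem summable_squarefreeTotientTerm : Summable (squarefreeTotientTerm ℝ) :=
  .of_nonneg_of_le squarefreeTotientTerm_nonneg squarefreeTotientTerm_le
    (by simp)

theorem sum_divisorsAntidiagonal_squarefreeTotientTerm (n : ℕ) :
    ∑ x ∈ n.divisorsAntidiagonal, squarefreeTotientTerm ℝ x.1 * (1 / (x.2 : ℝ) ^ 2) =
      1 / ((n : ℝ) * (Nat.totient n : ℝ)) := by
  rcases eq_or_ne n 0 with rfl | hn
  · simp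
  have hn' : (n : ℝ) ≠ 0 := Nat.cast_ne_zero.2 hn
  have hterm : ∀ x ∈ n.divisorsAntidiagonal,
      squarefreeTotientTerm ℝ x.1 * (1 / (x.2 : ℝ) ^ 2) =
        (if Squarefree x.1 then ((Nat.totient x.1 : ℝ))⁻¹ else 0) * ((n : ℝ) ^ 2)⁻¹ := by
    intro x hx
    have hx' : ((x.1 : ℝ) * x.2) = n := by
      exact_mod_cast (Nat.mem_divisorsAntidiagonal.1 hx).1
    unfold squarefreeTotientTerm
    rw [← hx']
    split_ifs
    · rw [mul_pow, mul_inv, one_div, one_div, mul_inv]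
      ring
    · simp
  rw [Finset.sum_congr rfl hterm, ← Finset.sum_mul,
    Nat.sum_divisorsAntidiagonal
      (fun e _ ↦ if Squarefree e then ((Nat.totient e : ℝ))⁻¹ else 0),
    ← Finset.sum_filter, Nat.sum_divisors_squarefree_inv_totient hn]
  field_simp

theorem hasSum_one_div_mul_totient :
    HasSum (fun d : ℕ ↦ 1 / ((d : ℝ) * (Nat.totient d : ℝ)))
      ((∑' e, squarefreeTotientTerm ℝ e) * (Real.pi ^ 2 / 6)) := by
  have hprod := summable_squarefreeTotientTerm.mul_of_nonneg hasSum_zeta_two.summable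
    squarefreeTotientTerm_nonneg (fun n ↦ by positivity)
  have h := (summable_squarefreeTotientTerm.hasSum.mul hasSum_zeta_two hprod).tsum_fiberwise
    (fun x : ℕ × ℕ ↦ x.1 * x.2)
  refine h.congr_fun fun n ↦ ?_
  rw [← sum_divisorsAntidiagonal_squarefreeTotientTerm n]
  rcases eq_or_ne n 0 with rfl | hn
  · rw [Nat.divisorsAntidiagonal_zero, Finset.sum_empty, eq_comm]
    convert tsum_zero with x
    rcases mul_eq_zero.1 x.2 with hx | hx <;> simp [hx, squarefreeTotientTerm]
  · have hfib : (fun x : ℕ × ℕ ↦ x.1 * x.2) ⁻¹' {n} = n.divisorsAntidiagonal := by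
      ext x
      simp [hn]
    rw [hfib, Finset.tsum_subtype' n.divisorsAntidiagonal
      (fun x : ℕ × ℕ ↦ squarefreeTotientTerm ℝ x.1 * (1 / (x.2 : ℝ) ^ 2))]

theorem tsum_squarefreeTotientTerm_le {N : ℕ} (hN : N ≠ 0) :
    ∑' e, squarefreeTotientTerm ℝ e ≤
      ∑ e ∈ Finset.range (N + 1), squarefreeTotientTerm ℝ e + (N : ℝ)⁻¹ := by
  refine Real.tsum_le_of_sum_range_le squarefreeTotientTerm_nonneg fun n ↦ ?_
  calc ∑ e ∈ Finset.range n, squarefreeTotientTerm ℝ e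
      ≤ ∑ e ∈ Finset.range (N + n + 1), squarefreeTotientTerm ℝ e :=
        Finset.sum_le_sum_of_subset_of_nonneg (Finset.range_mono (by omega))
          fun e _ _ ↦ squarefreeTotientTerm_nonneg e
    _ = ∑ e ∈ Finset.range (N + 1), squarefreeTotientTerm ℝ e +
          ∑ e ∈ Finset.Ioc N (N + n), squarefreeTotientTerm ℝ e := by
        rw [← Finset.sum_range_add_sum_Ico _ (by omega : N + 1 ≤ N + n + 1)]
        congr 2
        ext e
        simp only [Finset.mem_Ico, Finset.mem_Ioc]
        omega
    _ ≤ _ := by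
        gcongr
        calc ∑ e ∈ Finset.Ioc N (N + n), squarefreeTotientTerm ℝ e
            ≤ ∑ e ∈ Finset.Ioc N (N + n), ((e : ℝ) ^ 2)⁻¹ :=
              Finset.sum_le_sum fun e _ ↦ squarefreeTotientTerm_le e
          _ ≤ (N : ℝ)⁻¹ - ((N + n : ℕ) : ℝ)⁻¹ := sum_Ioc_inv_sq_le_sub hN (by omega)
          _ ≤ (N : ℝ)⁻¹ := sub_le_self _ (by positivity)

theorem sum_range_squarefreeTotientTerm_bounds :
    (1.338 : ℚ) < ∑ e ∈ Finset.range 101, squarefreeTotientTerm ℚ e ∧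
      ∑ e ∈ Finset.range 101, squarefreeTotientTerm ℚ e < 1.34 := by
  unfold squarefreeTotientTerm
  decide +kernel

theorem squarefreeTotientTerm_ratCast (e : ℕ) :
    ((squarefreeTotientTerm ℚ e : ℚ) : ℝ) = squarefreeTotientTerm ℝ e := by
  unfold squarefreeTotientTerm
  split_ifs <;> push_cast <;> rfl

/-- `2.2 < ∑_{d ≥ 1} 1/(d·φ(d)) < 2.23`, where `φ` is Euler's totient function.
(The `d = 0` term of the sum below is `1/0 = 0` in `ℝ`, so the sum is `∑_{d ≥ 1} 1/(d·φ(d))`.) -/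
theorem totient_series_bounds :
    2.2 < ∑' d : ℕ, 1 / ((d : ℝ) * (Nat.totient d : ℝ)) ∧
    ∑' d : ℕ, 1 / ((d : ℝ) * (Nat.totient d : ℝ)) < 2.23 := by
  have hcast : ((∑ e ∈ Finset.range 101, squarefreeTotientTerm ℚ e : ℚ) : ℝ) =
      ∑ e ∈ Finset.range 101, squarefreeTotientTerm ℝ e := by
    rw [Rat.cast_sum]
    exact Finset.sum_congr rfl fun e _ ↦ squarefreeTotientTerm_ratCast e
  have hlow : (1.338 : ℝ) < ∑ e ∈ Finset.range 101, squarefreeTotientTerm ℝ e := by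
    rw [← hcast]
    exact lt_of_eq_of_lt (by norm_num)
      ((Rat.cast_lt (K := ℝ)).2 sum_range_squarefreeTotientTerm_bounds.1)
  have hupp : ∑ e ∈ Finset.range 101, squarefreeTotientTerm ℝ e < (1.34 : ℝ) := by
    rw [← hcast]
    exact lt_of_lt_of_eq ((Rat.cast_lt (K := ℝ)).2 sum_range_squarefreeTotientTerm_bounds.2)
      (by norm_num)
  have hge := summable_squarefreeTotientTerm.sum_le_tsum (Finset.range 101)
    fun e _ ↦ squarefreeTotientTerm_nonneg e
  have hle := tsum_squarefreeTotientTerm_le (N := 100) (by norm_num)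
  norm_num at hle
  have hpi_gt := Real.pi_gt_d4
  have hpi_lt := Real.pi_lt_d4
  have hsq_gt : (9.869 : ℝ) < Real.pi ^ 2 := by nlinarith
  have hsq_lt : Real.pi ^ 2 < (9.8697 : ℝ) := by nlinarith
  rw [hasSum_one_div_mul_totient.tsum_eq]
  constructor <;> nlinarith
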